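/- arXiv:2511.12835 — 10 statements merged into one kernel-verified Lean document; each statement's English description precedes it below -/
import Mathlib

section
/- For every integer n ≥ 3 and every integer k, the identity A^k·C·A = C·A·W^k holds in PSL(2,ℝ) (i.e., the two sides are equal up to sign in SL(2,ℝ)). -/
open Matrix Real

/-- `SL(2,ℝ)`. -/
abbrev SL2 := Matrix.SpecialLinearGroup (Fin 2) ℝ

/-- The parabolic generator `A = [[1,t],[0,1]]`. -/
noncomputable def Amat (t : ℝ) : SL2 :=
  ⟨!![1, t; 0, 1], by norm_num [Matrix.det_fin_two_of]⟩

/-- The elliptic generator `C = [[0,-1],[1,0]]`. -/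
noncomputable def Cmat : SL2 :=
  ⟨!![0, -1; 1, 0], by norm_num [Matrix.det_fin_two_of]⟩

/-- `W = A⁻² · C · (A⁻¹ · C)^(n-3)`, with `t = 2 cos (π / n)`. -/
noncomputable def Wmat (n : ℕ) : SL2 :=
  (Amat (2 * Real.cos (Real.pi / n)))⁻¹ ^ 2 * Cmat *
    ((Amat (2 * Real.cos (Real.pi / n)))⁻¹ * Cmat) ^ (n - 3)

theorem Cmat_mul_self : Cmat * Cmat = -1 := by
  ext i j
  rw [Matrix.SpecialLinearGroup.coe_mul]
  fin_cases i <;> fin_cases j <;> simp [Cmat]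

theorem coe_Amat_inv_mul_Cmat (t : ℝ) :
    (((Amat t)⁻¹ * Cmat : SL2) : Matrix (Fin 2) (Fin 2) ℝ) = !![-t, -1; 1, 0] := by
  rw [Matrix.SpecialLinearGroup.coe_mul, Matrix.SpecialLinearGroup.coe_inv]
  ext i j
  fin_cases i <;> fin_cases j <;> simp [Amat, Cmat, Matrix.adjugate_fin_two]

/-- The powers of a matrix of trace `-2 cos θ` in terms of sines of multiples of `θ`. -/
theorem sin_smul_pow (θ : ℝ) (m : ℕ) :
    sin θ • !![-(2 * cos θ), -1; 1, 0] ^ m =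
      (-1 : ℝ) ^ m • !![sin (m * θ + θ), sin (m * θ); -sin (m * θ), -sin (m * θ - θ)] := by
  induction m with
  | zero => ext i j; fin_cases i <;> fin_cases j <;> simp
  | succ m ih =>
    rw [pow_succ, ← smul_mul_assoc, ih]
    ext i j
    fin_cases i <;> fin_cases j <;>
      simp [Matrix.mul_apply, Fin.sum_univ_two, add_mul, sin_add, sin_sub, cos_add, pow_succ] <;>
      first
      | ring1
      | linear_combination -(-1 : ℝ) ^ m * sin (m * θ) * sin_sq_add_cos_sq θ

/-- `A⁻¹ * C` has order dividing `n` up to sign. -/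
theorem Amat_inv_mul_Cmat_pow {n : ℕ} (hn : 2 ≤ n) :
    ((Amat (2 * cos (π / n)))⁻¹ * Cmat) ^ n = (-1) ^ (n + 1) := by
  have hn' : (2 : ℝ) ≤ n := by exact_mod_cast hn
  have hs : sin (π / n) ≠ 0 :=
    (sin_pos_of_pos_of_lt_pi (by positivity) (div_lt_self pi_pos (by linarith))).ne'
  have hmul : (n : ℝ) * (π / n) = π := by field_simp
  apply Subtype.ext
  apply smul_right_injective _ hs
  change sin (π / n) • _ = sin (π / n) • _
  rw [Matrix.SpecialLinearGroup.coe_pow, coe_Amat_inv_mul_Cmat, sin_smul_pow, hmul]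
  rcases Nat.even_or_odd n with h | h
  · rw [h.neg_one_pow, h.add_one.neg_one_pow]
    ext i j
    fin_cases i <;> fin_cases j <;> simp [sin_add, sin_sub]
  · rw [h.neg_one_pow, h.add_one.neg_one_pow]
    ext i j
    fin_cases i <;> fin_cases j <;> simp [sin_add, sin_sub]

/-- `C * A` conjugates `W` to `A` up to sign. -/
theorem conj_Wmat {n : ℕ} (hn : 3 ≤ n) :
    (Cmat * Amat (2 * cos (π / n))) * Wmat n * (Cmat * Amat (2 * cos (π / n)))⁻¹ =
      (-1) ^ n * Amat (2 * cos (π / n)) := by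
  have hU := Amat_inv_mul_Cmat_pow (n := n) (by lia)
  obtain ⟨m, rfl⟩ := Nat.exists_eq_add_of_le' hn
  have hW : Wmat (m + 3) = (Amat (2 * cos (π / (m + 3 : ℕ))))⁻¹ *
      ((Amat (2 * cos (π / (m + 3 : ℕ))))⁻¹ * Cmat) ^ (m + 1) := by
    simp only [Wmat, Nat.add_sub_cancel, pow_succ' _ m, pow_two, mul_assoc]
  rw [hW]
  generalize Amat (2 * cos (π / (m + 3 : ℕ))) = A at *
  have hC : Cmat⁻¹ = -Cmat := inv_eq_of_mul_eq_one_right (by rw [mul_neg, Cmat_mul_self, neg_neg])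
  have hCC (X : SL2) : Cmat * (Cmat * X) = -X := by
    rw [← mul_assoc, Cmat_mul_self, neg_one_mul]
  have hpow : (A⁻¹ * Cmat) ^ (m + 1) = (-1) ^ (m + 3 + 1) * (Cmat⁻¹ * A * (Cmat⁻¹ * A)) := by
    rw [← hU, pow_add _ (m + 1) 2, pow_two]
    simp only [mul_assoc, inv_mul_cancel_left, mul_inv_cancel_left, inv_mul_cancel, mul_one]
  rw [hpow]
  rcases Nat.even_or_odd (m + 3) with h | h
  · rw [h.add_one.neg_one_pow, h.neg_one_pow]
    simp [mul_assoc, hC, Cmat_mul_self, hCC]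
  · rw [h.add_one.neg_one_pow, h.neg_one_pow]
    simp [mul_assoc, hC, Cmat_mul_self, hCC]

theorem neg_one_zpow_SL2 (k : ℤ) : (-1 : SL2) ^ k = 1 ∨ (-1 : SL2) ^ k = -1 := by
  have h : (-1 : SL2) ^ (2 : ℤ) = 1 := by
    rw [zpow_two, neg_mul_neg, one_mul]
  rcases Int.even_or_odd' k with ⟨m, rfl | rfl⟩
  · left; rw [_root_.zpow_mul, h, _root_.one_zpow]
  · right; rw [_root_.zpow_add, _root_.zpow_mul, h, _root_.one_zpow, one_mul, zpow_one]

/-- For every integer `n ≥ 3` and every integer `k`, the identity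
`A^k · C · A = C · A · W^k` holds in `PSL(2,ℝ)`, i.e., up to sign in `SL(2,ℝ)`. -/
theorem stmt0 (n : ℕ) (hn : 3 ≤ n) (k : ℤ) :
    let A := Amat (2 * Real.cos (Real.pi / n))
    let C := Cmat
    let W := Wmat n
    ((A ^ k * C * A : SL2) : Matrix (Fin 2) (Fin 2) ℝ)
        = ((C * A * W ^ k : SL2) : Matrix (Fin 2) (Fin 2) ℝ) ∨
      ((A ^ k * C * A : SL2) : Matrix (Fin 2) (Fin 2) ℝ)
        = -((C * A * W ^ k : SL2) : Matrix (Fin 2) (Fin 2) ℝ) := by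
  intro A C W
  have hconj : (C * A) * W ^ k * (C * A)⁻¹ = (-1) ^ (n * k) * A ^ k := by
    rw [← conj_zpow, conj_Wmat hn,
      ((Commute.neg_one_left _).pow_left n).mul_zpow, _root_.zpow_mul, zpow_natCast]
  have hW : C * A * W ^ k = (-1) ^ (n * k) * A ^ k * (C * A) := by
    rw [← hconj, inv_mul_cancel_right]
  rw [hW]
  rcases neg_one_zpow_SL2 (n * k) with h | h
  · left; rw [h, one_mul, mul_assoc]
  · right
    rw [h, neg_mul, one_mul, neg_mul, Matrix.SpecialLinearGroup.coe_neg, neg_neg, mul_assoc]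
end

section
/- For every integer n ≥ 3 and all integers a and k, the identity (C⁻¹·A·C)·(A^k·C)^a·(C⁻¹·A·C)⁻¹ = (A⁻¹·C)^(n−3) · (W^(k−1)·(A⁻¹·C)⁻¹)^a · (A⁻¹·C)^(−(n−3)) holds in PSL(2,ℝ). -/
open Matrix Real

/-- Powers of `A⁻¹ * C` with `t = 2 cos θ`, in terms of sines of multiples of `θ`. -/
theorem sin_smul_Amat_inv_mul_Cmat_pow (θ : ℝ) (m : ℕ) :
    sin θ • ((((Amat (2 * cos θ))⁻¹ * Cmat) ^ m : SL2) : Matrix (Fin 2) (Fin 2) ℝ) =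
      (-1 : ℝ) ^ m • !![sin (m * θ + θ), sin (m * θ); -sin (m * θ), -sin (m * θ - θ)] := by
  induction m with
  | zero => ext i j; fin_cases i <;> fin_cases j <;> simp
  | succ m ih =>
    rw [pow_succ, Matrix.SpecialLinearGroup.coe_mul, ← smul_mul_assoc, ih, coe_Amat_inv_mul_Cmat]
    have hsq : sin θ ^ 2 = 1 - cos θ ^ 2 := sin_sq θ
    have hadd : ((m + 1 : ℕ) : ℝ) * θ = m * θ + θ := by push_cast; ring
    rw [hadd]
    ext i j
    fin_cases i <;> fin_cases j <;>
      simp [Matrix.mul_apply, Fin.sum_univ_two, sin_add, sin_sub, cos_add, pow_succ] <;>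
      grind

theorem Amat_inv_mul_Cmat_pow_mem_center {n : ℕ} (hn : 2 ≤ n) :
    ((Amat (2 * cos (π / n)))⁻¹ * Cmat) ^ n ∈ Subgroup.center SL2 := by
  have hn' : (2 : ℝ) ≤ n := by exact_mod_cast hn
  have hsin : sin (π / n) ≠ 0 :=
    (sin_pos_of_pos_of_lt_pi (by positivity) (div_lt_self pi_pos (by linarith))).ne'
  have hmul : (n : ℝ) * (π / n) = π := by field_simp
  have h := sin_smul_Amat_inv_mul_Cmat_pow (π / n) n
  rw [hmul] at h
  refine Matrix.SpecialLinearGroup.mem_center_iff.2 ⟨-(-1) ^ n, ?_, ?_⟩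
  · rw [Fintype.card_fin, neg_sq, ← pow_mul, mul_comm, pow_mul]; simp
  · apply smul_right_injective (Matrix (Fin 2) (Fin 2) ℝ) hsin
    dsimp only
    rw [h]
    ext i j
    fin_cases i <;> fin_cases j <;> simp [sin_add, sin_sub, mul_comm]

theorem Cmat_mul_Cmat_mem_center : Cmat * Cmat ∈ Subgroup.center SL2 := by
  refine Matrix.SpecialLinearGroup.mem_center_iff.2 ⟨-1, by simp, ?_⟩
  rw [Matrix.SpecialLinearGroup.coe_mul]
  ext i j
  fin_cases i <;> fin_cases j <;> simp [Cmat]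

/-- The conjugation identity in any group where `C` is an involution and `(A⁻¹ * C) ^ n = 1`. -/
theorem conj_zpow_eq_of_relations {G : Type*} [Group G] {A C : G} {n : ℕ} (hn : 3 ≤ n)
    (hC : C * C = 1) (hU : (A⁻¹ * C) ^ n = 1) (a k : ℤ) :
    (C⁻¹ * A * C) * (A ^ k * C) ^ a * (C⁻¹ * A * C)⁻¹ =
      (A⁻¹ * C) ^ ((n : ℤ) - 3) *
        ((A⁻¹ ^ 2 * C * (A⁻¹ * C) ^ (n - 3)) ^ (k - 1) * (A⁻¹ * C)⁻¹) ^ a *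
          (A⁻¹ * C) ^ (-((n : ℤ) - 3)) := by
  have hCinv : C⁻¹ = C := inv_eq_of_mul_eq_one_left hC
  have hCC (x : G) : C * (C * x) = x := by rw [← mul_assoc, hC, one_mul]
  have hpow : (A⁻¹ * C) ^ ((n : ℤ) - 3) = C * A * C * A * C * A := by
    rw [_root_.zpow_sub, zpow_natCast, hU]
    simp [zpow_ofNat, pow_succ, hCinv, mul_assoc]
  have hpow' : (A⁻¹ * C) ^ (n - 3) = C * A * C * A * C * A := by
    rw [← hpow, ← zpow_natCast]; congr 1; omega
  have hW : A⁻¹ ^ 2 * C * (C * A * C * A * C * A) =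
      (C * A * C * A * C * A)⁻¹ * (C * A * C) * A *
        ((C * A * C * A * C * A)⁻¹ * (C * A * C))⁻¹ := by
    simp [pow_two, hCinv, hCC, mul_assoc]
  rw [_root_.zpow_neg, hpow, hpow', hW, conj_zpow, ← conj_zpow, ← conj_zpow,
    _root_.zpow_sub_one]
  congr 1
  simp [hCinv, hCC, mul_assoc]

theorem coe_eq_or_eq_neg_of_mk_eq {g h : SL2}
    (hgh : (g : SL2 ⧸ Subgroup.center SL2) = h) :
    (g : Matrix (Fin 2) (Fin 2) ℝ) = (h : Matrix (Fin 2) (Fin 2) ℝ) ∨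
      (g : Matrix (Fin 2) (Fin 2) ℝ) = -(h : Matrix (Fin 2) (Fin 2) ℝ) := by
  obtain ⟨r, hr, hs⟩ := Matrix.SpecialLinearGroup.mem_center_iff.1
    ((QuotientGroup.eq (s := Subgroup.center SL2)).1 hgh.symm)
  rw [Fintype.card_fin] at hr
  have hg : (g : Matrix (Fin 2) (Fin 2) ℝ) = (h : Matrix (Fin 2) (Fin 2) ℝ) * scalar (Fin 2) r := by
    rw [hs, ← Matrix.SpecialLinearGroup.coe_mul, mul_inv_cancel_left]
  rcases sq_eq_sq_iff_eq_or_eq_neg.1 (hr.trans (one_pow 2).symm) with rfl | rfl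
  · left; simpa using hg
  · right; rw [hg, map_neg, map_one, mul_neg, mul_one]

/-- For every integer `n ≥ 3` and all integers `a` and `k`, the identity
`(C⁻¹·A·C)·(A^k·C)^a·(C⁻¹·A·C)⁻¹ = (A⁻¹·C)^(n−3) · (W^(k−1)·(A⁻¹·C)⁻¹)^a · (A⁻¹·C)^(−(n−3))`
holds in `PSL(2,ℝ)`, i.e., up to sign in `SL(2,ℝ)`. -/
theorem stmt1 (n : ℕ) (hn : 3 ≤ n) (a k : ℤ) :
    let A := Amat (2 * Real.cos (Real.pi / n))
    let C := Cmat
    let W := Wmat n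
    let lhs : SL2 := (C⁻¹ * A * C) * (A ^ k * C) ^ a * (C⁻¹ * A * C)⁻¹
    let rhs : SL2 := (A⁻¹ * C) ^ ((n : ℤ) - 3) * (W ^ (k - 1) * (A⁻¹ * C)⁻¹) ^ a *
      (A⁻¹ * C) ^ (-((n : ℤ) - 3))
    (lhs : Matrix (Fin 2) (Fin 2) ℝ) = (rhs : Matrix (Fin 2) (Fin 2) ℝ) ∨
      (lhs : Matrix (Fin 2) (Fin 2) ℝ) = -(rhs : Matrix (Fin 2) (Fin 2) ℝ) := by
  intro A C W lhs rhs
  apply coe_eq_or_eq_neg_of_mk_eq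
  have hC : (C : SL2 ⧸ Subgroup.center SL2) * C = 1 :=
    (QuotientGroup.eq_one_iff _).2 Cmat_mul_Cmat_mem_center
  have hU : ((A : SL2 ⧸ Subgroup.center SL2)⁻¹ * C) ^ n = 1 :=
    (QuotientGroup.eq_one_iff _).2 (Amat_inv_mul_Cmat_pow_mem_center (by omega))
  exact conj_zpow_eq_of_relations hn hC hU a k
end

section
/- Fix an integer n ≥ 3 and set t = 2·cos(π/n). Define s₀ = t and, for 0 ≤ i ≤ n−4, s_{i+1} = t − 1/s_i (this is the Möbius action of A·C, since (A·C)·x = t − 1/x). Then s_i > 0 for every 0 ≤ i ≤ n−3 (so the recursion is well defined), the sequence is strictly decreasing: t = s₀ > s₁ > ⋯ > s_{n−3}, and s_{n−3} = 1/t. Consequently 2t − 1/s_{n−3} = t, i.e. the Möbius transformation of A²·C maps s_{n−3} to t, so the Möbius transformation of A²·C·(A·C)^(n−3) fixes t. -/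
open Real

theorem sin_add_two_mul_add_sin (x θ : ℝ) :
    Real.sin (x + 2 * θ) + Real.sin x = 2 * Real.cos θ * Real.sin (x + θ) := by
  rw [Real.sin_add, Real.sin_add, Real.sin_two_mul, Real.cos_two_mul]
  ring

theorem sin_add_mul_sin_sub_sin_add_mul_sin (a b θ : ℝ) :
    Real.sin (a + θ) * Real.sin b - Real.sin (b + θ) * Real.sin a =
      Real.sin θ * Real.sin (b - a) := by
  rw [Real.sin_add, Real.sin_add, Real.sin_sub]
  ring

theorem sin_natCast_mul_pi_div_pos {n k : ℕ} (hk : 0 < k) (hkn : k < n) :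
    0 < Real.sin (k * (Real.pi / n)) := by
  have hn : (0 : ℝ) < n := by exact_mod_cast hk.trans hkn
  have hk' : (0 : ℝ) < k := by exact_mod_cast hk
  have hkn' : (k : ℝ) < n := by exact_mod_cast hkn
  apply Real.sin_pos_of_pos_of_lt_pi
  · have := Real.pi_pos
    positivity
  · calc (k : ℝ) * (Real.pi / n) < n * (Real.pi / n) := by
          have := div_pos Real.pi_pos hn
          gcongr
      _ = Real.pi := by field_simp

/-- A solution of `s (i + 1) = 2 cos θ - 1 / s i` starting at `2 cos θ` is a quotient of
consecutive values of `k ↦ sin (k θ)`, as long as these values do not vanish. -/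
theorem eq_sin_div_sin_of_recurrence {θ : ℝ} {s : ℕ → ℝ} {N : ℕ}
    (hsin : ∀ i ≤ N, Real.sin ((i + 1) * θ) ≠ 0)
    (h0 : s 0 = 2 * Real.cos θ)
    (hrec : ∀ i, i + 1 ≤ N → s (i + 1) = 2 * Real.cos θ - 1 / s i) :
    ∀ i ≤ N, s i = Real.sin ((i + 1) * θ + θ) / Real.sin ((i + 1) * θ) := by
  intro i
  induction i with
  | zero =>
    intro h
    have h1 := hsin 0 h
    rw [h0, eq_div_iff h1]
    have := sin_add_two_mul_add_sin 0 θ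
    simp only [zero_add, Real.sin_zero, add_zero] at this
    simp only [Nat.cast_zero, zero_add, one_mul, ← this]
    congr 1
    ring
  | succ i ih =>
    intro h
    have h2 := hsin (i + 1) h
    rw [hrec i h, ih (by omega), one_div_div, Nat.cast_succ]
    rw [Nat.cast_succ] at h2
    have e : ((i : ℝ) + 1) * θ + θ = (i + 1 + 1) * θ := by ring
    have key := sin_add_two_mul_add_sin ((i + 1) * θ) θ
    rw [e] at key ⊢
    rw [eq_div_iff h2, sub_mul, div_mul_cancel₀ _ h2, ← key, add_sub_cancel_right]
    congr 1
    ring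

/-- Fix an integer `n ≥ 3` and set `t = 2 cos(π/n)`.  Define `s₀ = t` and, for
`0 ≤ i ≤ n − 4`, `s_{i+1} = t − 1/s_i` (the Möbius action of `A·C`).  Then `s_i > 0` for every
`0 ≤ i ≤ n − 3`, the sequence is strictly decreasing `t = s₀ > s₁ > ⋯ > s_{n−3}`, and
`s_{n−3} = 1/t`.  Consequently `2t − 1/s_{n−3} = t`, i.e. the Möbius transformation of `A²·C`
maps `s_{n−3}` to `t`, so the Möbius transformation of `A²·C·(A·C)^(n−3)` fixes `t`. -/
theorem stmt6 (n : ℕ) (hn : 3 ≤ n) (s : ℕ → ℝ)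
    (h0 : s 0 = 2 * Real.cos (Real.pi / n))
    (hrec : ∀ i, i + 1 ≤ n - 3 → s (i + 1) = 2 * Real.cos (Real.pi / n) - 1 / s i) :
    (∀ i ≤ n - 3, 0 < s i) ∧
      (∀ i j, i < j → j ≤ n - 3 → s j < s i) ∧
      s (n - 3) = 1 / (2 * Real.cos (Real.pi / n)) ∧
      2 * (2 * Real.cos (Real.pi / n)) - 1 / s (n - 3) = 2 * Real.cos (Real.pi / n) := by
  have hn0 : (n : ℝ) ≠ 0 := by
    have : n ≠ 0 := by omega
    exact_mod_cast this
  set θ : ℝ := Real.pi / n with hθ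
  have hnθ : n * θ = Real.pi := by rw [hθ]; field_simp
  have hpos : ∀ k : ℕ, 0 < k → k < n → 0 < Real.sin (k * θ) := fun k h h' =>
    sin_natCast_mul_pi_div_pos h h'
  have hden : ∀ i ≤ n - 3, 0 < Real.sin ((i + 1) * θ) := fun i hi => by
    simpa using hpos (i + 1) (by omega) (by omega)
  have hnum : ∀ i ≤ n - 3, 0 < Real.sin ((i + 1) * θ + θ) := fun i hi => by
    have := hpos (i + 2) (by omega) (by omega)
    convert this using 2
    push_cast
    ring
  have hs := eq_sin_div_sin_of_recurrence (fun i hi => (hden i hi).ne') h0 hrec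
  have hlast : s (n - 3) = 1 / (2 * Real.cos θ) := by
    have hsinθ : Real.sin θ ≠ 0 := by
      simpa using (hden 0 (Nat.zero_le _)).ne'
    have hcast : ((n - 3 : ℕ) : ℝ) = n - 3 := by
      rw [Nat.cast_sub hn, Nat.cast_ofNat]
    have e1 : ((n : ℝ) - 3 + 1) * θ + θ = Real.pi - θ := by rw [← hnθ]; ring
    have e2 : ((n : ℝ) - 3 + 1) * θ = Real.pi - 2 * θ := by rw [← hnθ]; ring
    rw [hs _ le_rfl, hcast, e1, e2, Real.sin_pi_sub, Real.sin_pi_sub, Real.sin_two_mul,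
      mul_right_comm, div_mul_cancel_right₀ hsinθ, one_div]
  refine ⟨fun i hi => ?_, fun i j hij hj => ?_, hlast, ?_⟩
  · rw [hs i hi]
    exact div_pos (hnum i hi) (hden i hi)
  · have hi : i ≤ n - 3 := by omega
    rw [hs i hi, hs j hj, div_lt_div_iff₀ (hden j hj) (hden i hi), ← sub_pos,
      sin_add_mul_sin_sub_sin_add_mul_sin]
    have h1 := hpos 1 one_pos (by omega)
    have h2 := hpos (j - i) (by omega) (by omega)
    rw [Nat.cast_one, one_mul] at h1
    rw [Nat.cast_sub hij.le] at h2
    have e : ((j : ℝ) + 1) * θ - (i + 1) * θ = (j - i) * θ := by ring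
    rw [e]
    exact mul_pos h1 h2
  · rw [hlast, one_div_one_div]
    ring
end

section
/- Fix an integer n ≥ 3 and set t = 2·cos(π/n). Define ℓ₀ = −t and, for 0 ≤ i ≤ n−4, ℓ_{i+1} = −1/ℓ_i − t (this is the Möbius action of A⁻¹·C, since (A⁻¹·C)·x = −1/x − t). Then ℓ_i < 0 for every 0 ≤ i ≤ n−3 (so the recursion is well defined), the sequence is strictly increasing: −t = ℓ₀ < ℓ₁ < ⋯ < ℓ_{n−3}, and ℓ_{n−3} = −1/t. Consequently −1/ℓ_{n−3} − 2t = −t, i.e. the Möbius transformation of A⁻²·C maps ℓ_{n−3} back to −t, so the Möbius transformation of W = A⁻²·C·(A⁻¹·C)^(n−3) fixes −t. -/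
open Real

/-- The orbit of `-2 cos θ` under `x ↦ -1 / x - 2 cos θ` is a quotient of sines, as long as no
denominator vanishes. -/
theorem eq_neg_sin_div_sin_of_rec {θ : ℝ} {N : ℕ} {l : ℕ → ℝ} (h0 : l 0 = -(2 * cos θ))
    (hrec : ∀ i, i + 1 ≤ N → l (i + 1) = -1 / l i - 2 * cos θ)
    (hsin : ∀ i ≤ N, sin ((i + 1) * θ) ≠ 0) {i : ℕ} (hi : i ≤ N) :
    l i = -(sin ((i + 1) * θ + θ) / sin ((i + 1) * θ)) := by
  induction i with
  | zero =>
    have h := hsin 0 hi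
    simp only [Nat.cast_zero, zero_add, one_mul] at h ⊢
    rw [h0, ← two_mul, sin_two_mul]
    field_simp
  | succ k ih =>
    have h₁ := hsin k (by omega)
    have h₂ := hsin (k + 1) hi
    have hk : ((k + 1 : ℕ) + 1 : ℝ) * θ = (k + 1) * θ + θ := by push_cast; ring
    rw [hk] at h₂ ⊢
    rw [hrec k hi, ih (by omega)]
    have key : sin ((k + 1) * θ + θ + θ)
        = 2 * cos θ * sin ((k + 1) * θ + θ) - sin ((k + 1) * θ) := by
      rw [sin_add _ θ, cos_add, sin_add]
      linear_combination (-sin ((k + 1) * θ)) * sin_sq_add_cos_sq θ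
    rw [key]
    generalize sin ((k + 1) * θ + θ) = y at h₂ ⊢
    generalize sin ((k + 1) * θ) = x at h₁ ⊢
    field_simp
    ring

/-- The translated sine quotient `x ↦ sin (x + θ) / sin x` decreases strictly on `(0, π)`. -/
theorem sin_add_div_sin_lt {θ a b : ℝ} (hθ : 0 < sin θ) (ha : 0 < a) (hab : a < b) (hb : b < π) :
    sin (b + θ) / sin b < sin (a + θ) / sin a := by
  rw [div_lt_div_iff₀ (sin_pos_of_pos_of_lt_pi (ha.trans hab) hb)
    (sin_pos_of_pos_of_lt_pi ha (hab.trans hb))]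
  have h := mul_pos hθ (sin_pos_of_pos_of_lt_pi (sub_pos.2 hab) (by linarith))
  rw [sin_sub] at h
  rw [sin_add, sin_add]
  linarith

/-- Fix an integer `n ≥ 3` and set `t = 2 cos(π/n)`.  Define `ℓ₀ = −t` and, for
`0 ≤ i ≤ n − 4`, `ℓ_{i+1} = −1/ℓ_i − t` (the Möbius action of `A⁻¹·C`).  Then `ℓ_i < 0` for
every `0 ≤ i ≤ n − 3`, the sequence is strictly increasing `−t = ℓ₀ < ℓ₁ < ⋯ < ℓ_{n−3}`, and
`ℓ_{n−3} = −1/t`.  Consequently `−1/ℓ_{n−3} − 2t = −t`, i.e. the Möbius transformation of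
`A⁻²·C` maps `ℓ_{n−3}` back to `−t`, so the Möbius transformation of
`W = A⁻²·C·(A⁻¹·C)^(n−3)` fixes `−t`. -/
theorem stmt7 (n : ℕ) (hn : 3 ≤ n) (l : ℕ → ℝ)
    (h0 : l 0 = -(2 * Real.cos (Real.pi / n)))
    (hrec : ∀ i, i + 1 ≤ n - 3 → l (i + 1) = -1 / l i - 2 * Real.cos (Real.pi / n)) :
    (∀ i ≤ n - 3, l i < 0) ∧
      (∀ i j, i < j → j ≤ n - 3 → l i < l j) ∧
      l (n - 3) = -1 / (2 * Real.cos (Real.pi / n)) ∧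
      -1 / l (n - 3) - 2 * (2 * Real.cos (Real.pi / n)) = -(2 * Real.cos (Real.pi / n)) := by
  have hn' : (3 : ℝ) ≤ n := by exact_mod_cast hn
  set θ : ℝ := π / n with hθ
  have hnθ : n * θ = π := by rw [hθ]; field_simp
  have hθ0 : 0 < θ := by positivity
  have hbound : ∀ i ≤ n - 3, ((i : ℝ) + 1) * θ + θ < π := by
    intro i hi
    have : (i : ℝ) + 3 ≤ n := by exact_mod_cast (by omega : i + 3 ≤ n)
    nlinarith
  have hpos : ∀ i : ℕ, 0 < ((i : ℝ) + 1) * θ := fun i => by positivity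
  have hsin : ∀ i ≤ n - 3, 0 < sin (((i : ℝ) + 1) * θ) := fun i hi =>
    sin_pos_of_pos_of_lt_pi (hpos i) (by linarith [hbound i hi])
  have hl : ∀ i ≤ n - 3, l i = -(sin ((i + 1) * θ + θ) / sin ((i + 1) * θ)) := fun i hi =>
    eq_neg_sin_div_sin_of_rec h0 hrec (fun i hi => (hsin i hi).ne') hi
  have hsinθ : 0 < sin θ := sin_pos_of_pos_of_lt_pi hθ0 (by nlinarith)
  have hcos : 0 < cos θ := cos_pos_of_mem_Ioo ⟨by linarith [pi_pos], by nlinarith⟩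
  have hlast : l (n - 3) = -1 / (2 * cos θ) := by
    rw [hl _ le_rfl]
    have h : ((n - 3 : ℕ) + 1 : ℝ) * θ = π - 2 * θ := by
      rw [← hnθ, Nat.cast_sub hn]
      push_cast
      ring
    rw [h, show π - 2 * θ + θ = π - θ by ring, sin_pi_sub, sin_pi_sub, sin_two_mul]
    field_simp
  refine ⟨fun i hi => ?_, fun i j hij hj => ?_, hlast, ?_⟩
  · rw [hl i hi]
    exact neg_neg_of_pos (div_pos
      (sin_pos_of_pos_of_lt_pi (by linarith [hpos i]) (hbound i hi)) (hsin i hi))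
  · rw [hl i (by omega), hl j hj]
    have hij' : (i : ℝ) < j := by exact_mod_cast hij
    exact neg_lt_neg (sin_add_div_sin_lt hsinθ (hpos i) (by gcongr)
      (by linarith [hbound j hj]))
  · rw [hlast]
    field_simp
    ring
end

section
/- For every integer n ≥ 3, with t = 2·cos(π/n), the identity A⁻²·C·(A⁻¹·C)^(n−3) = [[1+t², t³],[−t, 1−t²]] holds in PSL(2,ℝ), i.e. the matrix product on the left equals [[1+t², t³],[−t, 1−t²]] up to sign in SL(2,ℝ). -/
open Matrix Real

/-- The powers of `[[−2 cos θ, −1], [1, 0]]`, whose eigenvalues are `−exp(±iθ)`. -/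
theorem sin_smul_pow_companion (θ : ℝ) (k : ℕ) :
    sin θ • (!![-(2 * cos θ), -1; 1, 0] : Matrix (Fin 2) (Fin 2) ℝ) ^ k =
      (-1 : ℝ) ^ k • !![sin (k * θ + θ), sin (k * θ); -sin (k * θ), -sin (k * θ - θ)] := by
  induction k with
  | zero => ext i j; fin_cases i <;> fin_cases j <;> simp
  | succ k ih =>
    have h1 : ((k + 1 : ℕ) : ℝ) * θ = k * θ + θ := by push_cast; ring
    have h2 : sin (k * θ + θ + θ) = 2 * cos θ * sin (k * θ + θ) - sin (k * θ) := by
      simp only [sin_add, cos_add]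
      linear_combination -sin (k * θ) * sin_sq_add_cos_sq θ
    have h3 : sin (k * θ - θ) = 2 * cos θ * sin (k * θ) - sin (k * θ + θ) := by
      simp only [sin_add, sin_sub]
      ring
    rw [pow_succ, ← smul_mul_assoc, ih, h1, h2, h3, add_sub_cancel_right]
    ext i j
    fin_cases i <;> fin_cases j <;> simp [Matrix.mul_apply, Fin.sum_univ_two, pow_succ] <;> ring

/-- For every integer `n ≥ 3`, with `t = 2 cos(π/n)`, the identity
`A⁻²·C·(A⁻¹·C)^(n−3) = [[1+t², t³],[−t, 1−t²]]` holds in `PSL(2,ℝ)`, i.e. the matrix product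
on the left equals `[[1+t², t³],[−t, 1−t²]]` up to sign in `SL(2,ℝ)`. -/
theorem stmt8 (n : ℕ) (hn : 3 ≤ n) :
    let t : ℝ := 2 * Real.cos (Real.pi / n)
    let A : Matrix (Fin 2) (Fin 2) ℝ := !![1, t; 0, 1]
    let C : Matrix (Fin 2) (Fin 2) ℝ := !![0, -1; 1, 0]
    let W : Matrix (Fin 2) (Fin 2) ℝ := A⁻¹ ^ 2 * C * (A⁻¹ * C) ^ (n - 3)
    let M : Matrix (Fin 2) (Fin 2) ℝ := !![1 + t ^ 2, t ^ 3; -t, 1 - t ^ 2]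
    W = M ∨ W = -M := by
  intro t A C W M
  obtain ⟨k, rfl⟩ := Nat.exists_eq_add_of_le' hn
  set θ : ℝ := π / (k + 3 : ℕ) with hθ
  have hk : (k : ℝ) * θ = π - 3 * θ := by
    rw [hθ]; push_cast; field_simp; ring
  have hsin : sin θ ≠ 0 := by
    refine (sin_pos_of_pos_of_lt_pi (by positivity) (div_lt_self pi_pos ?_)).ne'
    exact_mod_cast (by omega : 1 < k + 3)
  have hA : A⁻¹ = !![1, -t; 0, 1] := by
    refine Matrix.inv_eq_right_inv ?_
    ext i j
    fin_cases i <;> fin_cases j <;> simp [A, Matrix.mul_apply, Fin.sum_univ_two]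
  have hAC : A⁻¹ * C = !![-(2 * cos θ), -1; 1, 0] := by
    change A⁻¹ * C = !![-t, -1; 1, 0]
    rw [hA]
    ext i j
    fin_cases i <;> fin_cases j <;> simp [C, Matrix.mul_apply, Fin.sum_univ_two]
  have h2 : sin (k * θ + θ) = sin θ * t := by
    rw [hk, show π - 3 * θ + θ = π - 2 * θ by ring, sin_pi_sub, sin_two_mul]
    ring
  have h3 : sin (k * θ) = sin θ * (t ^ 2 - 1) := by
    rw [hk, sin_pi_sub, sin_three_mul]
    linear_combination -4 * sin θ * sin_sq_add_cos_sq θ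
  have h4 : sin (k * θ - θ) = sin θ * (t ^ 3 - 2 * t) := by
    rw [hk, show π - 3 * θ - θ = π - 2 * (2 * θ) by ring, sin_pi_sub, sin_two_mul, sin_two_mul,
      cos_two_mul]
    ring
  have hpow : (A⁻¹ * C) ^ k =
      (-1 : ℝ) ^ k • !![t, t ^ 2 - 1; -(t ^ 2 - 1), -(t ^ 3 - 2 * t)] := by
    apply smul_right_injective _ hsin
    simp only
    rw [hAC, sin_smul_pow_companion, h2, h3, h4, smul_comm]
    congr 1
    ext i j
    fin_cases i <;> fin_cases j <;> simp <;> ring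
  have hW : W = -((-1 : ℝ) ^ k • M) := by
    simp only [W, Nat.add_sub_cancel]
    rw [hpow, hA, mul_smul_comm, ← smul_neg]
    congr 1
    ext i j
    fin_cases i <;> fin_cases j <;>
      simp [C, M, pow_two, Matrix.mul_apply, Fin.sum_univ_two] <;> ring
  rcases neg_one_pow_eq_or ℝ k with h | h
  · right; rw [hW, h, one_smul]
  · left; rw [hW, h, neg_smul, one_smul, neg_neg]
end

section
/- Let a, b, c, d be real numbers with a·d − b·c = 1. Let μ be the measure on ℝ² given by Lebesgue measure with density (x,y) ↦ ((1 + x·y)²)⁻¹, let U = {(x,y) ∈ ℝ² : c·x + d ≠ 0 and a − b·y ≠ 0}, and define 𝒯(x,y) = ((a·x+b)/(c·x+d), (d·y−c)/(a−b·y)). Then 𝒯 is injective on U and is measure preserving from μ restricted to U to μ restricted to the image 𝒯(U). -/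
open MeasureTheory

theorem hasDerivAt_mobius {a b c d x : ℝ} (hdet : a * d - b * c = 1) (hx : c * x + d ≠ 0) :
    HasDerivAt (fun x => (a * x + b) / (c * x + d)) ((c * x + d) ^ 2)⁻¹ x := by
  have h1 : HasDerivAt (fun x => a * x + b) a x := by
    simpa using ((hasDerivAt_id x).const_mul a).add_const b
  have h2 : HasDerivAt (fun x => c * x + d) c x := by
    simpa using ((hasDerivAt_id x).const_mul c).add_const d
  refine (h1.fun_div h2 hx).congr_deriv ?_
  rw [← one_div]
  congr 1
  linear_combination hdet

theorem mobius_injOn {a b c d : ℝ} (hdet : a * d - b * c = 1) :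
    Set.InjOn (fun x => (a * x + b) / (c * x + d)) {x | c * x + d ≠ 0} := by
  intro x hx y hy h
  have h' := (div_eq_div_iff hx hy).1 h
  linear_combination h' - (x - y) * hdet

theorem one_add_mobius_mul_mobius {a b c d x y : ℝ} (hdet : a * d - b * c = 1)
    (hx : c * x + d ≠ 0) (hy : a - b * y ≠ 0) :
    1 + (a * x + b) / (c * x + d) * ((d * y - c) / (a - b * y)) =
      (1 + x * y) / ((c * x + d) * (a - b * y)) := by
  rw [div_mul_div_comm, eq_div_iff (mul_ne_zero hx hy), add_mul,
    div_mul_cancel₀ _ (mul_ne_zero hx hy)]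
  linear_combination (1 + x * y) * hdet

theorem ContinuousLinearMap.det_prodMap_toSpanSingleton (u v : ℝ) :
    ((ContinuousLinearMap.toSpanSingleton ℝ u).prodMap
      (ContinuousLinearMap.toSpanSingleton ℝ v)).det = u * v := by
  rw [ContinuousLinearMap.det, ContinuousLinearMap.coe_prodMap, LinearMap.det_prodMap]
  simp

/-- Let `a, b, c, d` be real numbers with `a·d − b·c = 1`.  Let `μ` be the measure on `ℝ²`
given by Lebesgue measure with density `(x,y) ↦ ((1 + x·y)²)⁻¹`, let
`U = {(x,y) : c·x + d ≠ 0 and a − b·y ≠ 0}`, and define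
`𝒯(x,y) = ((a·x+b)/(c·x+d), (d·y−c)/(a−b·y))`.  Then `𝒯` is injective on `U` and is measure
preserving from `μ` restricted to `U` to `μ` restricted to the image `𝒯(U)`. -/
theorem stmt12 (a b c d : ℝ) (hdet : a * d - b * c = 1) :
    let μ : Measure (ℝ × ℝ) :=
      (volume : Measure (ℝ × ℝ)).withDensity
        (fun p => ENNReal.ofReal (((1 + p.1 * p.2) ^ 2)⁻¹))
    let U : Set (ℝ × ℝ) := {p | c * p.1 + d ≠ 0 ∧ a - b * p.2 ≠ 0}
    let T : ℝ × ℝ → ℝ × ℝ :=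
      fun p => ((a * p.1 + b) / (c * p.1 + d), (d * p.2 - c) / (a - b * p.2))
    Set.InjOn T U ∧ MeasurePreserving T (μ.restrict U) (μ.restrict (T '' U)) := by
  intro μ U T
  have hdet' : d * a - -c * -b = 1 := by linear_combination hdet
  have hsnd (y : ℝ) : (d * y + -c) / (-b * y + a) = (d * y - c) / (a - b * y) := by
    rw [neg_mul, neg_add_eq_sub, ← sub_eq_add_neg]
  have hden (y : ℝ) : -b * y + a = a - b * y := by ring
  have hinj : Set.InjOn T U := by
    intro p hp q hq h
    obtain ⟨h1, h2⟩ := Prod.ext_iff.1 h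
    refine Prod.ext (mobius_injOn hdet hp.1 hq.1 h1) (mobius_injOn hdet' ?_ ?_ ?_)
    · simpa only [Set.mem_ofPred_eq, hden] using hp.2
    · simpa only [Set.mem_ofPred_eq, hden] using hq.2
    · simpa only [hsnd] using h2
  have hT : Measurable T := by fun_prop
  have hU : MeasurableSet U := by
    have h1 : Measurable fun p : ℝ × ℝ => c * p.1 + d := by fun_prop
    have h2 : Measurable fun p : ℝ × ℝ => a - b * p.2 := by fun_prop
    exact (h1 (measurableSet_singleton 0).compl).inter (h2 (measurableSet_singleton 0).compl)
  let T' (p : ℝ × ℝ) : ℝ × ℝ →L[ℝ] ℝ × ℝ :=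
    (ContinuousLinearMap.toSpanSingleton ℝ ((c * p.1 + d) ^ 2)⁻¹).prodMap
      (ContinuousLinearMap.toSpanSingleton ℝ ((a - b * p.2) ^ 2)⁻¹)
  have hT' (p : ℝ × ℝ) (hp : p ∈ U) : HasFDerivAt T (T' p) p := by
    have h1 := hasDerivAt_mobius hdet hp.1
    have h2 := hasDerivAt_mobius hdet' (x := p.2) (by simpa only [hden] using hp.2)
    simp only [hden, ← sub_eq_add_neg] at h2
    exact h1.hasFDerivAt.prodMap p h2.hasFDerivAt
  refine ⟨hinj, hT, Measure.ext fun s hs => ?_⟩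
  rw [Measure.map_apply hT hs, Measure.restrict_apply (hT hs), Measure.restrict_apply hs,
    ← Set.image_preimage_inter, withDensity_apply' _ _, withDensity_apply' _ _,
    lintegral_image_eq_lintegral_abs_det_fderiv_mul volume ((hT hs).inter hU)
      (fun p hp => (hT' p hp.2).hasFDerivWithinAt) (hinj.mono Set.inter_subset_right)]
  refine setLIntegral_congr_fun ((hT hs).inter hU) fun p hp => ?_
  obtain ⟨h1, h2⟩ := hp.2
  simp only [T', T]
  rw [← ENNReal.ofReal_mul (abs_nonneg _), one_add_mobius_mul_mobius hdet h1 h2,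
    ContinuousLinearMap.det_prodMap_toSpanSingleton, abs_of_nonneg (by positivity)]
  congr 1
  rw [div_pow, inv_div, mul_pow, ← mul_inv, ← mul_div_assoc,
    inv_mul_cancel₀ (mul_ne_zero (pow_ne_zero 2 h1) (pow_ne_zero 2 h2)), one_div]
end

section
/- Let a, b, c, d be real numbers with a·d − b·c = 1, and let x, y be real numbers with c·x + d > 0. Set t₀ = −2·log(c·x+d), let A(x,y) denote the matrix [[x, x·y−1],[1, y]], and let g_t denote the matrix [[e^{t/2}, 0],[0, e^{−t/2}]]. Then, as 2×2 real matrices, [[a,b],[c,d]] · A(x,y) · g_{t₀} = A(x', y'), where x' = (a·x+b)/(c·x+d) and y' = (c·x+d)²·y − c·(c·x+d). -/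
open Matrix Real

/-- Arnoux's transversal matrix `A(x,y) = [[x, x·y−1],[1, y]]`. -/
def arnouxMat (x y : ℝ) : Matrix (Fin 2) (Fin 2) ℝ := !![x, x * y - 1; 1, y]

/-- The geodesic-flow matrix `g_t = [[e^{t/2}, 0],[0, e^{−t/2}]]`. -/
noncomputable def geoMat (t : ℝ) : Matrix (Fin 2) (Fin 2) ℝ :=
  !![Real.exp (t / 2), 0; 0, Real.exp (-t / 2)]

/-- Let `a, b, c, d` be real numbers with `a·d − b·c = 1`, and let `x, y` be real numbers with
`c·x + d > 0`.  Set `t₀ = −2·log(c·x+d)`.  Then, as `2×2` real matrices,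
`[[a,b],[c,d]] · A(x,y) · g_{t₀} = A(x', y')`, where `x' = (a·x+b)/(c·x+d)` and
`y' = (c·x+d)²·y − c·(c·x+d)`. -/
theorem stmt13 (a b c d x y : ℝ) (hdet : a * d - b * c = 1) (h : 0 < c * x + d) :
    let t₀ : ℝ := -2 * Real.log (c * x + d)
    let x' : ℝ := (a * x + b) / (c * x + d)
    let y' : ℝ := (c * x + d) ^ 2 * y - c * (c * x + d)
    !![a, b; c, d] * arnouxMat x y * geoMat t₀ = arnouxMat x' y' := by
  intro t₀ x' y'
  have hne : c * x + d ≠ 0 := h.ne'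
  have hexp : Real.exp (t₀ / 2) = (c * x + d)⁻¹ := by
    rw [show t₀ / 2 = -Real.log (c * x + d) by ring, Real.exp_neg, Real.exp_log h]
  have hexp_neg : Real.exp (-t₀ / 2) = c * x + d := by
    rw [neg_div, Real.exp_neg, hexp, inv_inv]
  simp only [arnouxMat, geoMat, hexp, hexp_neg, x', y']
  ext i j
  fin_cases i <;> fin_cases j <;> simp [Matrix.mul_apply, Fin.sum_univ_two]
  · rfl
  · have hprod : (a * x + b) / (c * x + d) * ((c * x + d) ^ 2 * y - c * (c * x + d)) =
        (a * x + b) * ((c * x + d) * y - c) := by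
      rw [div_mul_eq_mul_div, div_eq_iff hne]
      ring
    rw [hprod]
    linear_combination -hdet
  · field_simp
  · ring
end

section
/- Let a, b, c, d be real numbers with a·d − b·c = 1, and let x, y be real numbers with 1 + x·y ≠ 0, c·x + d ≠ 0, and a − b·y ≠ 0. Set x' = (a·x+b)/(c·x+d) and y' = (d·y−c)/(a−b·y). Then 1 + x'·y' ≠ 0 and y'/(1 + x'·y') = (c·x+d)²·(y/(1 + x·y)) − c·(c·x+d). -/
/-- Let `a, b, c, d` be real numbers with `a·d − b·c = 1`, and let `x, y` be real numbers with
`1 + x·y ≠ 0`, `c·x + d ≠ 0`, and `a − b·y ≠ 0`.  Set `x' = (a·x+b)/(c·x+d)` and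
`y' = (d·y−c)/(a−b·y)`.  Then `1 + x'·y' ≠ 0` and
`y'/(1 + x'·y') = (c·x+d)²·(y/(1 + x·y)) − c·(c·x+d)`. -/
theorem stmt14 (a b c d x y : ℝ) (hdet : a * d - b * c = 1)
    (h0 : 1 + x * y ≠ 0) (h1 : c * x + d ≠ 0) (h2 : a - b * y ≠ 0) :
    let x' : ℝ := (a * x + b) / (c * x + d)
    let y' : ℝ := (d * y - c) / (a - b * y)
    1 + x' * y' ≠ 0 ∧
      y' / (1 + x' * y') = (c * x + d) ^ 2 * (y / (1 + x * y)) - c * (c * x + d) := by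
  intro x' y'
  have key : 1 + x' * y' = (1 + x * y) / ((c * x + d) * (a - b * y)) := by
    simp only [x', y']
    rw [div_mul_div_comm, eq_div_iff (mul_ne_zero h1 h2), add_mul,
      div_mul_cancel₀ _ (mul_ne_zero h1 h2)]
    linear_combination (1 + x * y) * hdet
  refine ⟨key ▸ div_ne_zero h0 (mul_ne_zero h1 h2), ?_⟩
  have hy : y' / (1 + x' * y') = (d * y - c) * (c * x + d) / (1 + x * y) := by
    simp only [key, y']
    rw [div_div_eq_mul_div, mul_comm (c * x + d), ← mul_assoc, div_mul_cancel₀ _ h2]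
  have hq : y / (1 + x * y) * (1 + x * y) = y := div_mul_cancel₀ _ h0
  rw [hy, div_eq_iff h0]
  linear_combination -(c * x + d) ^ 2 * hq
end

section
/- The double integral ∫₀¹ ( ∫_{−1}^{0} (−2·log x)/(1 + x·y)² dy ) dx equals π²/3, where log denotes the natural logarithm. -/
open Real intervalIntegral

lemma intervalIntegrable_pow_mul_log (n : ℕ) (a b : ℝ) :
    IntervalIntegrable (fun x : ℝ => x ^ n * Real.log x) MeasureTheory.volume a b :=
  intervalIntegrable_log'.continuousOn_mul (continuous_pow n).continuousOn

lemma integral_pow_mul_log_zero_one (n : ℕ) :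
    ∫ x in (0:ℝ)..1, x ^ n * Real.log x = -(1 / ((n : ℝ) + 1) ^ 2) := by
  have hn : (n : ℝ) + 1 ≠ 0 := by positivity
  have hderiv : ∀ x ∈ Set.Ioo (0:ℝ) 1,
      HasDerivAt (fun x : ℝ => x ^ n * (x * Real.log x) / (n + 1) - x ^ (n + 1) / ((n : ℝ) + 1) ^ 2)
        (x ^ n * Real.log x) x := by
    intro x hx
    have hx0 : x ≠ 0 := hx.1.ne'
    have h := (((hasDerivAt_pow (n + 1) x).mul (Real.hasDerivAt_log hx0)).div_const
      ((n : ℝ) + 1)).sub ((hasDerivAt_pow (n + 1) x).div_const (((n : ℝ) + 1) ^ 2))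
    convert! h using 1
    · ext y
      simp only [Pi.sub_apply, Pi.mul_apply]
      ring
    · push_cast
      field_simp
      ring
  have hcont : Continuous
      (fun x : ℝ => x ^ n * (x * Real.log x) / (n + 1) - x ^ (n + 1) / ((n : ℝ) + 1) ^ 2) :=
    (((continuous_pow n).mul Real.continuous_mul_log).div_const _).sub
      ((continuous_pow (n + 1)).div_const _)
  rw [integral_eq_sub_of_hasDerivAt_of_le zero_le_one hcont.continuousOn hderiv
    (intervalIntegrable_pow_mul_log n 0 1)]
  simp

lemma integral_inv_one_add_mul_sq {x : ℝ} (hx0 : 0 ≤ x) (hx1 : x < 1) :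
    ∫ y in (-1:ℝ)..0, ((1 + x * y) ^ 2)⁻¹ = (1 - x)⁻¹ := by
  have hpos : ∀ y ∈ Set.uIcc (-1:ℝ) 0, 1 + x * y ≠ 0 := by
    intro y hy
    rw [Set.uIcc_of_le (by norm_num)] at hy
    nlinarith [hy.1, hy.2]
  have hderiv : ∀ y ∈ Set.uIcc (-1:ℝ) 0,
      HasDerivAt (fun y : ℝ => y / (1 + x * y)) (((1 + x * y) ^ 2)⁻¹) y := by
    intro y hy
    have h := (hasDerivAt_id y).div (((hasDerivAt_id y).const_mul x).const_add 1) (hpos y hy)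
    convert! h using 1
    have := hpos y hy
    simp only [id]
    field_simp
    ring
  rw [integral_eq_sub_of_hasDerivAt hderiv
    (ContinuousOn.intervalIntegrable (ContinuousOn.inv₀ (by fun_prop)
      fun y hy => pow_ne_zero 2 (hpos y hy)))]
  have : 1 - x ≠ 0 := by linarith
  have h' : 1 + x * (-1) = 1 - x := by ring
  rw [h']
  field_simp
  simp

lemma hasSum_integral_log_div_one_sub :
    HasSum (fun n : ℕ => 2 * (1 / ((n : ℝ) + 1) ^ 2))
      (∫ x in (0:ℝ)..1, -2 * Real.log x * (1 - x)⁻¹) := by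
  have hval (n : ℕ) : ∫ x in Set.Ioo (0:ℝ) 1, -2 * (x ^ n * Real.log x)
      = 2 * (1 / ((n : ℝ) + 1) ^ 2) := by
    rw [← MeasureTheory.integral_Ioc_eq_integral_Ioo, ← integral_of_le zero_le_one,
      integral_const_mul, integral_pow_mul_log_zero_one]
    ring
  have hint (n : ℕ) : MeasureTheory.Integrable (fun x : ℝ => -2 * (x ^ n * Real.log x))
      (MeasureTheory.volume.restrict (Set.Ioo (0:ℝ) 1)) :=
    (((intervalIntegrable_iff_integrableOn_Ioo_of_le zero_le_one).1
      (intervalIntegrable_pow_mul_log n 0 1))).const_mul (-2)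
  have hnorm (n : ℕ) : ∫ x in Set.Ioo (0:ℝ) 1, ‖-2 * (x ^ n * Real.log x)‖
      = 2 * (1 / ((n : ℝ) + 1) ^ 2) := by
    rw [← hval n]
    refine MeasureTheory.setIntegral_congr_fun measurableSet_Ioo fun x hx => ?_
    have := mul_nonneg (pow_nonneg hx.1.le n) (neg_nonneg.2 (Real.log_nonpos hx.1.le hx.2.le))
    exact Real.norm_of_nonneg (by linarith)
  have hsummable : Summable fun n : ℕ => 2 * (1 / ((n : ℝ) + 1) ^ 2) := by
    have h := (summable_nat_add_iff 1).2 hasSum_zeta_two.summable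
    push_cast at h
    exact h.mul_left 2
  have h := MeasureTheory.hasSum_integral_of_summable_integral_norm hint
    (by simpa only [hnorm] using hsummable)
  simp only [hval] at h
  have heq : ∫ x in (0:ℝ)..1, -2 * Real.log x * (1 - x)⁻¹ =
      ∫ x in Set.Ioo (0:ℝ) 1, ∑' n : ℕ, -2 * (x ^ n * Real.log x) := by
    rw [integral_of_le zero_le_one, MeasureTheory.integral_Ioc_eq_integral_Ioo]
    refine MeasureTheory.setIntegral_congr_fun measurableSet_Ioo fun x hx => ?_
    have hgeom := (hasSum_geometric_of_lt_one hx.1.le hx.2).mul_left (-2 * Real.log x)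
    rw [← hgeom.tsum_eq]
    exact tsum_congr fun n => by ring
  rwa [heq]

/-- The double integral `∫₀¹ ( ∫_{−1}^{0} (−2·log x)/(1 + x·y)² dy ) dx` equals `π²/3`,
where `log` denotes the natural logarithm. -/
theorem stmt17 :
    (∫ x in (0:ℝ)..1, ∫ y in (-1:ℝ)..0, (-2 * Real.log x) / (1 + x * y) ^ 2) =
      Real.pi ^ 2 / 3 := by
  have hinner : (∫ x in (0:ℝ)..1, ∫ y in (-1:ℝ)..0, (-2 * Real.log x) / (1 + x * y) ^ 2) =
      ∫ x in (0:ℝ)..1, -2 * Real.log x * (1 - x)⁻¹ := by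
    simp only [integral_of_le (zero_le_one (α := ℝ)), MeasureTheory.integral_Ioc_eq_integral_Ioo]
    refine MeasureTheory.setIntegral_congr_fun measurableSet_Ioo fun x hx => ?_
    simp only [div_eq_mul_inv]
    rw [integral_const_mul, integral_inv_one_add_mul_sq hx.1.le hx.2]
  have hzeta := ((hasSum_nat_add_iff' 1).2 hasSum_zeta_two).mul_left 2
  push_cast at hzeta
  rw [hinner, hasSum_integral_log_div_one_sub.unique hzeta]
  simp
  ring
end

section
/- Fix an integer n ≥ 3 and set t = 1 + 2·cos(π/n). Define r₀ = t and, for 0 ≤ i ≤ n−3, r_{i+1} = (t·r_i − t − 1)/(r_i − 1) (this is the Möbius action of A₃·C₃², where A₃ = [[1,t],[0,1]] and C₃ = [[1,−1],[1,0]]). Then r_i > 1 for every 0 ≤ i ≤ n−3 (so the recursion is well defined), the sequence is strictly decreasing: t = r₀ > r₁ > ⋯ > r_{n−2}, and r_{n−2} = 1. Consequently the Möbius transformation of A₃·C₃·(A₃·C₃²)^(n−2) fixes t. -/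
open Real

/-- Addition formula behind the Chebyshev recursion. -/
lemma sin_add_two_mul_angle (a θ : ℝ) :
    sin (a + θ + θ) = 2 * cos θ * sin (a + θ) - sin a := by
  rw [sin_add (a + θ), cos_add, sin_add]
  linear_combination -sin a * sin_sq_add_cos_sq θ

/-- Closed form of the orbit of `1 + 2 cos θ` under `x ↦ (t x - t - 1) / (x - 1)`,
`t = 1 + 2 cos θ`, as long as the sines involved do not vanish. -/
lemma orbit_eq_one_add_sin_div_sin (θ : ℝ) (m : ℕ) (r : ℕ → ℝ)
    (hpos : ∀ i ≤ m, 0 < sin ((i + 1) * θ))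
    (h0 : r 0 = 1 + 2 * cos θ)
    (hrec : ∀ i, i + 1 ≤ m →
      r (i + 1) = ((1 + 2 * cos θ) * r i - (1 + 2 * cos θ) - 1) / (r i - 1))
    (i : ℕ) (hi : i ≤ m) : r i = 1 + sin ((i + 1) * θ + θ) / sin ((i + 1) * θ) := by
  induction i with
  | zero =>
    have h := hpos 0 hi
    simp only [Nat.cast_zero, zero_add, one_mul] at h ⊢
    rw [h0, ← two_mul, sin_two_mul]
    field_simp
  | succ k ih =>
    have h1 := hpos k (by omega)
    have h2 := hpos (k + 1) hi
    have e : ((k + 1 : ℕ) + 1 : ℝ) * θ = (k + 1) * θ + θ := by push_cast; ring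
    rw [e] at h2 ⊢
    rw [hrec k hi, ih (by omega), sin_add_two_mul_angle]
    generalize sin ((k + 1) * θ + θ) = y at *
    generalize sin ((k + 1) * θ) = x at *
    rw [add_sub_cancel_left]
    field_simp
    ring

/-- Fix an integer `n ≥ 3` and set `t = 1 + 2 cos(π/n)` (the translation length `t_{3,n}`).
Define `r₀ = t` and, for `0 ≤ i ≤ n − 3`, `r_{i+1} = (t·r_i − t − 1)/(r_i − 1)` (the Möbius
action of `A₃·C₃²`).  Then `r_i > 1` for every `0 ≤ i ≤ n − 3`, the sequence is strictly
decreasing `t = r₀ > r₁ > ⋯ > r_{n−2}`, and `r_{n−2} = 1`.  Consequently the Möbius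
transformation of `A₃·C₃·(A₃·C₃²)^(n−2)`, whose last factor `A₃·C₃` acts by
`x ↦ ((1+t)·x − 1)/x`, fixes `t`. -/
theorem stmt19 (n : ℕ) (hn : 3 ≤ n) (r : ℕ → ℝ)
    (h0 : r 0 = 1 + 2 * Real.cos (Real.pi / n))
    (hrec : ∀ i, i + 1 ≤ n - 2 →
      r (i + 1) = ((1 + 2 * Real.cos (Real.pi / n)) * r i - (1 + 2 * Real.cos (Real.pi / n)) - 1)
        / (r i - 1)) :
    (∀ i ≤ n - 3, 1 < r i) ∧
      (∀ i j, i < j → j ≤ n - 2 → r j < r i) ∧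
      r (n - 2) = 1 ∧
      ((1 + (1 + 2 * Real.cos (Real.pi / n))) * r (n - 2) - 1) / r (n - 2)
        = 1 + 2 * Real.cos (Real.pi / n) := by
  have hn0 : (0 : ℝ) < n := by exact_mod_cast (by omega : 0 < n)
  set θ := Real.pi / n with hθ
  have hθ0 : 0 < θ := div_pos pi_pos hn0
  have hnθ : n * θ = Real.pi := by rw [hθ]; field_simp
  have hsin : ∀ k : ℕ, 0 < k → k < n → 0 < sin (k * θ) := fun k hk hkn => by
    apply sin_pos_of_pos_of_lt_pi (mul_pos (by exact_mod_cast hk) hθ0)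
    rw [← hnθ]
    exact mul_lt_mul_of_pos_right (by exact_mod_cast hkn) hθ0
  have hpos : ∀ i ≤ n - 2, 0 < sin ((i + 1) * θ) := fun i hi => by
    exact_mod_cast hsin (i + 1) (by omega) (by omega)
  have hr := orbit_eq_one_add_sin_div_sin θ (n - 2) r hpos h0 hrec
  have hlast : r (n - 2) = 1 := by
    have e : ((n - 2 : ℕ) + 1 : ℝ) * θ + θ = Real.pi := by
      rw [← hnθ, Nat.cast_sub (by omega)]
      push_cast
      ring
    rw [hr _ le_rfl, e, sin_pi, zero_div, add_zero]
  refine ⟨fun i hi => ?_, fun i j hij hj => ?_, hlast, ?_⟩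
  · rw [hr i (by omega)]
    have h := hpos (i + 1) (by omega)
    have e : ((i + 1 : ℕ) + 1 : ℝ) * θ = (i + 1) * θ + θ := by push_cast; ring
    rw [e] at h
    exact lt_add_of_pos_right 1 (div_pos h (hpos i (by omega)))
  · rw [hr i (by omega), hr j hj, add_lt_add_iff_left,
      div_lt_div_iff₀ (hpos j hj) (hpos i (by omega))]
    have hs : 0 < sin θ := by simpa using hsin 1 one_pos (by omega)
    have hd := hsin (j - i) (by omega) (by omega)
    have e : ((j - i : ℕ) : ℝ) * θ = (j + 1) * θ - (i + 1) * θ := by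
      rw [Nat.cast_sub hij.le]
      ring
    rw [e, sin_sub] at hd
    rw [sin_add _ θ, sin_add _ θ]
    linarith [mul_pos hs hd]
  · rw [hlast]
    ring
end
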